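/- arXiv:1907.07451 — 8 statements merged into one kernel-verified Lean document; each statement's English description precedes it below -/
import Mathlib

section
/- Let a : ℕ → ℝ be a sequence of real numbers and k ∈ ℝ. If the sequence of differences a(n+1) − a(n) converges to k as n → ∞, then the sequence a(n)/n also converges to k as n → ∞. -/
open Filter

theorem cauchy_thm1_seq (a : ℕ → ℝ) (k : ℝ)
    (h : Tendsto (fun n => a (n + 1) - a n) atTop (nhds k)) :
    Tendsto (fun n => a n / n) atTop (nhds k) := by
  have h_sum := h.cesaro.add (tendsto_const_div_atTop_nhds_zero_nat (a 0))
  rw [add_zero] at h_sum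
  refine h_sum.congr fun n => ?_
  rw [Finset.sum_range_sub]
  ring
end

section
/- Let a : ℕ → ℝ be a sequence with a(n) > 0 for all n, and let k > 0 be a real number. If the sequence of ratios a(n+1)/a(n) converges to k as n → ∞, then the sequence of n-th roots (a(n))^(1/n) (real power with exponent 1/n) also converges to k as n → ∞. -/
open Filter

/-- The logarithmic (additive) form of the ratio-to-root comparison: the mean increment of a
sequence converges to the limit of its increments. -/
theorem tendsto_div_of_tendsto_succ_sub {b : ℕ → ℝ} {l : ℝ}
    (h : Tendsto (fun n => b (n + 1) - b n) atTop (nhds l)) :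
    Tendsto (fun n : ℕ => b n / n) atTop (nhds l) := by
  have hzero : Tendsto (fun n : ℕ => b 0 / n) atTop (nhds 0) :=
    tendsto_const_div_atTop_nhds_zero_nat (b 0)
  have hsum := h.cesaro.add hzero
  rw [add_zero] at hsum
  refine hsum.congr fun n => ?_
  rw [Finset.sum_range_sub]
  ring

theorem cauchy_thm2_seq (a : ℕ → ℝ) (k : ℝ) (ha : ∀ n, 0 < a n) (hk : 0 < k)
    (h : Tendsto (fun n => a (n + 1) / a n) atTop (nhds k)) :
    Tendsto (fun n : ℕ => (a n) ^ ((1 : ℝ) / n)) atTop (nhds k) := by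
  have hlog : Tendsto (fun n => Real.log (a (n + 1)) - Real.log (a n)) atTop
      (nhds (Real.log k)) :=
    (h.log hk.ne').congr fun n => Real.log_div (ha (n + 1)).ne' (ha n).ne'
  have hexp := (tendsto_div_of_tendsto_succ_sub (b := fun n => Real.log (a n)) hlog).rexp
  rw [Real.exp_log hk] at hexp
  refine hexp.congr fun n => ?_
  rw [Real.rpow_def_of_pos (ha n), mul_one_div]
end

section
/- Let f : ℝ → ℝ be a continuous function and k ∈ ℝ. If f(x+1) − f(x) converges to k as x → +∞ (along the filter atTop on ℝ), then f(x)/x also converges to k as x → +∞. -/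
open Filter

section NormedGroup

variable {E : Type*} [SeminormedAddCommGroup E] {g : ℝ → E}

theorem norm_le_add_mul_of_norm_sub_le {a C ε : ℝ} (hε : 0 ≤ ε)
    (hC : ∀ x ∈ Set.Icc a (a + 1), ‖g x‖ ≤ C)
    (hg : ∀ x, a ≤ x → ‖g (x + 1) - g x‖ ≤ ε) {x : ℝ} (hx : a ≤ x) :
    ‖g x‖ ≤ C + ε * (x - a) := by
  have key : ∀ n : ℕ, ∀ y ∈ Set.Icc a (a + 1), ‖g (y + n)‖ ≤ C + ε * n := by
    intro n y hy
    induction n with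
    | zero => simpa using hC y hy
    | succ n ih =>
      have hstep := hg (y + n) (le_add_of_le_of_nonneg hy.1 n.cast_nonneg)
      have htri := norm_le_norm_add_norm_sub' (g (y + n + 1)) (g (y + n))
      push_cast
      rw [← add_assoc y]
      linarith
  have hle := Nat.floor_le (sub_nonneg.2 hx)
  have hlt := Nat.lt_floor_add_one (x - a)
  have h := key ⌊x - a⌋₊ (x - ⌊x - a⌋₊) ⟨by linarith, by linarith⟩
  rw [sub_add_cancel] at h
  exact h.trans (by gcongr)

theorem Continuous.isLittleO_id_of_tendsto_sub_zero (hg : Continuous g)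
    (h : Tendsto (fun x => g (x + 1) - g x) atTop (nhds 0)) :
    g =o[atTop] (id : ℝ → ℝ) := by
  refine Asymptotics.isLittleO_iff.2 fun ε hε => ?_
  obtain ⟨b, hb⟩ := eventually_atTop.1 <|
    (tendsto_zero_iff_norm_tendsto_zero.1 h).eventually_le_const (half_pos hε)
  obtain ⟨C, hC⟩ := (isCompact_Icc (a := max b 0) (b := max b 0 + 1)).exists_bound_of_continuousOn
    hg.continuousOn
  filter_upwards [eventually_ge_atTop (max b 0), eventually_ge_atTop (C / (ε / 2))] with x hx hxC
  have hbound := norm_le_add_mul_of_norm_sub_le (half_pos hε).le hC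
    (fun y hy => hb y ((le_max_left _ _).trans hy)) hx
  have hC' := (div_le_iff₀ (half_pos hε)).1 hxC
  have ha : 0 ≤ ε / 2 * max b 0 := by positivity
  rw [id, Real.norm_of_nonneg ((le_max_right _ _).trans hx)]
  linarith

end NormedGroup

theorem cauchy_thm1_real (f : ℝ → ℝ) (k : ℝ) (hf : Continuous f)
    (h : Tendsto (fun x => f (x + 1) - f x) atTop (nhds k)) :
    Tendsto (fun x => f x / x) atTop (nhds k) := by
  have hg : Continuous fun x => f x - k * x := by fun_prop
  have hsub : Tendsto (fun x => (f (x + 1) - k * (x + 1)) - (f x - k * x)) atTop (nhds 0) := by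
    convert h.sub_const k using 2 <;> ring
  have hlim := (hg.isLittleO_id_of_tendsto_sub_zero hsub).tendsto_div_nhds_zero.add_const k
  rw [zero_add] at hlim
  refine hlim.congr' ?_
  filter_upwards [eventually_ne_atTop 0] with x hx
  rw [id]
  field_simp
  ring
end

section
/- Let f : ℝ → ℝ be a continuous function with f(x) > 0 for all x, and let k > 0 be a real number. If f(x+1)/f(x) converges to k as x → +∞ (along the filter atTop on ℝ), then f(x)^(1/x) (real power) also converges to k as x → +∞. -/
open Filter

/-- A continuous function whose unit increments tend to zero at infinity is sublinear there. -/
theorem Continuous.isLittleO_id_of_tendsto_add_one_sub {u : ℝ → ℝ} (hu : Continuous u)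
    (h : Tendsto (fun x => u (x + 1) - u x) atTop (nhds 0)) : u =o[atTop] (id : ℝ → ℝ) := by
  rw [Asymptotics.isLittleO_iff]
  intro ε hε
  obtain ⟨a, ha⟩ := eventually_atTop.1 (Metric.tendsto_nhds.1 h (ε / 2) (half_pos hε))
  set X := max a 0
  have hstep : ∀ x ≥ X, |u (x + 1) - u x| < ε / 2 := fun x hx => by
    simpa [Real.dist_eq] using ha x ((le_max_left a 0).trans hx)
  obtain ⟨C, hC⟩ := (isCompact_Icc (a := X) (b := X + 1)).exists_bound_of_continuousOn
    hu.continuousOn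
  have bound : ∀ n : ℕ, ∀ x, X ≤ x → x ≤ X + 1 + n → |u x| ≤ C + ε / 2 * (x - X) := by
    intro n
    induction n with
    | zero =>
      intro x h₁ h₂
      have := hC x ⟨h₁, by simpa using h₂⟩
      rw [Real.norm_eq_abs] at this
      nlinarith
    | succ n ih =>
      intro x h₁ h₂
      push_cast at h₂
      by_cases hx : x ≤ X + 1
      · exact ih x h₁ (hx.trans (by simp))
      · have hprev := ih (x - 1) (by linarith) (by linarith)
        have hinc := hstep (x - 1) (by linarith)
        rw [sub_add_cancel] at hinc
        have := abs_sub_abs_le_abs_sub (u x) (u (x - 1))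
        linarith
  filter_upwards [eventually_ge_atTop X, eventually_ge_atTop (2 * C / ε)] with x hx hCx
  have hX : 0 ≤ X := le_max_right a 0
  obtain ⟨n, hn⟩ := exists_nat_ge (x - X - 1)
  have hb := bound n x hx (by linarith)
  rw [div_le_iff₀ hε] at hCx
  rw [id, Real.norm_eq_abs, Real.norm_of_nonneg (hX.trans hx)]
  nlinarith

/-- If the unit increments of a continuous function tend to `L` at infinity, so does `g x / x`. -/
theorem Continuous.tendsto_div_id_of_tendsto_add_one_sub {g : ℝ → ℝ} {L : ℝ} (hg : Continuous g)
    (h : Tendsto (fun x => g (x + 1) - g x) atTop (nhds L)) :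
    Tendsto (fun x => g x / x) atTop (nhds L) := by
  have hu : Continuous fun x => g x - L * x := by fun_prop
  have hsub : Tendsto (fun x => (g (x + 1) - L * (x + 1)) - (g x - L * x)) atTop (nhds 0) := by
    rw [← sub_self L]
    exact (h.sub_const L).congr fun x => by ring
  have hlim := (hu.isLittleO_id_of_tendsto_add_one_sub hsub).tendsto_div_nhds_zero.add_const L
  rw [zero_add] at hlim
  refine hlim.congr' ?_
  filter_upwards [eventually_ne_atTop 0] with x hx
  simp only [id]
  field_simp
  ring

theorem cauchy_thm2_real (f : ℝ → ℝ) (k : ℝ) (hf : Continuous f)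
    (hpos : ∀ x, 0 < f x) (hk : 0 < k)
    (h : Tendsto (fun x => f (x + 1) / f x) atTop (nhds k)) :
    Tendsto (fun x => (f x) ^ (1 / x)) atTop (nhds k) := by
  have hlog : Continuous fun x => Real.log (f x) := hf.log fun x => (hpos x).ne'
  have hinc : Tendsto (fun x => Real.log (f (x + 1)) - Real.log (f x)) atTop
      (nhds (Real.log k)) :=
    (h.log hk.ne').congr fun x => Real.log_div (hpos _).ne' (hpos _).ne'
  have hexp := (Real.continuous_exp.tendsto _).comp
    (hlog.tendsto_div_id_of_tendsto_add_one_sub hinc)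
  rw [Real.exp_log hk] at hexp
  refine hexp.congr fun x => ?_
  rw [Function.comp_apply, Real.rpow_def_of_pos (hpos x), mul_one_div]
end

section
/- Let f : ℝ → ℝ, t, d ∈ ℝ. Then f has derivative d at t (HasDerivAt f d t) if and only if for every infinitesimal hyperreal Δ ≠ 0, the hyperreal quotient (f*(t + Δ) − f(t))/Δ is infinitely close to d, i.e., IsSt ((f*(t + Δ) − f(t))/Δ) d, where f* denotes the natural extension of f to the hyperreals (applying f termwise to a representing sequence, i.e., Germ.map f on Hyperreal = Germ (hyperfilter ℕ) ℝ). -/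
open Hyperreal Filter

/-- The natural extension of `f : ℝ → ℝ` to the hyperreals, applying `f`
termwise to a representing sequence (`Germ.map f` on `Hyperreal`). -/
noncomputable def hyperExtension (f : ℝ → ℝ) : ℝ* → ℝ* := Germ.map f

/-- Convergence along a countably generated filter can be tested on sequences indexed by the
hyperfilter on `ℕ`. -/
theorem tendsto_iff_forall_tendsto_hyperfilter {α β : Type*} {g : α → β} {l : Filter α}
    [l.IsCountablyGenerated] {m : Filter β} :
    Tendsto g l m ↔
      ∀ u : ℕ → α, Tendsto u (hyperfilter ℕ) l → Tendsto (g ∘ u) (hyperfilter ℕ) m := by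
  refine ⟨fun h u hu => h.comp hu, fun h => ?_⟩
  by_contra hg
  obtain ⟨s, hs, hfreq⟩ := not_tendsto_iff_exists_frequently_notMem.1 hg
  obtain ⟨u, hu, hus⟩ := exists_seq_forall_of_frequently hfreq
  obtain ⟨n, hn⟩ := ((h u (hu.mono_left Nat.hyperfilter_le_atTop)).eventually hs).exists
  exact hus n hn

set_option linter.deprecated false in
theorem infinitesimal_ofSeq_and_ne_zero_iff {u : ℕ → ℝ} :
    Infinitesimal (ofSeq u) ∧ ofSeq u ≠ 0 ↔
      Tendsto u (hyperfilter ℕ) (nhdsWithin 0 {0}ᶜ) := by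
  rw [tendsto_nhdsWithin_iff, Infinitesimal, isSt_ofSeq_iff_tendsto]
  refine and_congr_right fun _ => ?_
  have : ofSeq u = 0 ↔ ∀ᶠ n in (hyperfilter ℕ : Filter ℕ), u n = 0 := Germ.coe_eq
  rw [ne_eq, this, ← Ultrafilter.eventually_not]
  rfl

theorem hyperExtension_quotient_ofSeq (f : ℝ → ℝ) (t : ℝ) (u : ℕ → ℝ) :
    (hyperExtension f ((t : ℝ*) + ofSeq u) - (f t : ℝ*)) / ofSeq u =
      ofSeq ((fun h => h⁻¹ • (f (t + h) - f t)) ∘ u) := by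
  rw [div_eq_inv_mul]
  rfl

theorem hasDerivAt_iff_isSt (f : ℝ → ℝ) (t d : ℝ) :
    HasDerivAt f d t ↔
      ∀ Δ : ℝ*, Infinitesimal Δ → Δ ≠ 0 →
        IsSt ((hyperExtension f ((t : ℝ*) + Δ) - (f t : ℝ*)) / Δ) d := by
  rw [hasDerivAt_iff_tendsto_slope_zero, tendsto_iff_forall_tendsto_hyperfilter,
    ofSeq_surjective.forall]
  refine forall_congr' fun u => ?_
  rw [← and_imp, infinitesimal_ofSeq_and_ne_zero_iff, hyperExtension_quotient_ofSeq,
    isSt_ofSeq_iff_tendsto]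
end

section
/- Let f : ℝ → ℝ and L ∈ ℝ. Then f(t) tends to L as t tends to 0 with t ≠ 0 (Tendsto f (nhdsWithin 0 {0}ᶜ) (nhds L)) if and only if for every infinitesimal hyperreal ε ≠ 0, the value f*(ε) of the natural hyperreal extension of f is infinitely close to L, i.e., IsSt (f*(ε)) L, where f* denotes the extension of f to the hyperreals obtained by applying f termwise to a representing sequence (Germ.map f on Hyperreal = Germ (hyperfilter ℕ) ℝ). -/
open Hyperreal Filter

theorem tendsto_iff_isSt (f : ℝ → ℝ) (L : ℝ) :
    Tendsto f (nhdsWithin 0 {0}ᶜ) (nhds L) ↔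
      ∀ e : ℝ*, Infinitesimal e → e ≠ 0 → IsSt (Germ.map f e : ℝ*) L := by
  have ofSeq_ne_zero (u : ℕ → ℝ) : ofSeq u ≠ 0 ↔ ∀ᶠ n in hyperfilter ℕ, u n ≠ 0 :=
    (not_congr Germ.coe_eq).trans Ultrafilter.eventually_not.symm
  constructor
  · intro hf e he hne
    obtain ⟨u, rfl⟩ := ofSeq_surjective e
    exact isSt_ofSeq_iff_tendsto.2 <| hf.comp <|
      tendsto_nhdsWithin_iff.2 ⟨isSt_ofSeq_iff_tendsto.1 he, (ofSeq_ne_zero u).1 hne⟩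
  · intro h
    by_contra hf
    obtain ⟨s, hs, hfreq⟩ := not_tendsto_iff_exists_frequently_notMem.1 hf
    obtain ⟨u, hu, hus⟩ := exists_seq_forall_of_frequently hfreq
    obtain ⟨hu0, hune⟩ := tendsto_nhdsWithin_iff.1 (hu.mono_left Nat.hyperfilter_le_atTop)
    have hlim : Tendsto (f ∘ u) (hyperfilter ℕ) (nhds L) :=
      isSt_ofSeq_iff_tendsto.1 <|
        h (ofSeq u) (isSt_ofSeq_iff_tendsto.2 hu0) ((ofSeq_ne_zero u).2 hune)
    obtain ⟨n, hn⟩ := (hlim.eventually hs).exists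
    exact hus n hn
end

section
/- For every complex number z, the sequence n ↦ ((1 + z·i/n)^n + (1 − z·i/n)^n)/2 (indexed by positive natural numbers n) converges to cos z as n → ∞. -/
open Filter Complex

theorem deProny_cos (z : ℂ) :
    Tendsto (fun n : ℕ => ((1 + z * I / n) ^ n + (1 - z * I / n) ^ n) / 2)
      atTop (nhds (Complex.cos z)) := by
  have h := ((tendsto_one_add_div_pow_exp (z * I)).add
    (tendsto_one_add_div_pow_exp (-z * I))).div_const 2
  simpa only [Complex.cos, neg_mul, neg_div, ← sub_eq_add_neg] using h
end

section
/- For every complex number z, the sequence n ↦ ((1 + z·i/n)^n − (1 − z·i/n)^n)/(2·i) (indexed by positive natural numbers n) converges to sin z as n → ∞. -/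
open Filter Complex

theorem deProny_sin (z : ℂ) :
    Tendsto (fun n : ℕ => ((1 + z * I / n) ^ n - (1 - z * I / n) ^ n) / (2 * I))
      atTop (nhds (Complex.sin z)) := by
  have hsin : Complex.sin z = (exp (z * I) - exp (-(z * I))) / (2 * I) := by
    rw [Complex.sin, neg_mul, eq_div_iff (by simp)]
    linear_combination (exp (-(z * I)) - exp (z * I)) * I_sq
  rw [hsin]
  refine ((tendsto_one_add_div_pow_exp (z * I)).sub ?_).div_const _
  simpa only [neg_div, ← sub_eq_add_neg] using tendsto_one_add_div_pow_exp (-(z * I))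
end
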